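/- Define σ : ℝ → ℝ by σ(x) = sig(1/4, 3/4, x) + 2·sig(9/4, 11/4, x) and ξ : ℝ → ℝ by ξ(x) = x − σ(x). Let w : ℕ → ℝ be any sequence with w(n) ∈ {1, 3} for all n. Then 1/3 ≤ enc(w) ≤ 1, σ(4·enc(w)) = w(0), and ξ(4·enc(w)) = enc(n ↦ w(n+1)). (Thus σ extracts the leading radix-4 digit and ξ the fractional remainder on encodings using only the digits 1 and 3.) -/

import Mathlib

/-- The piecewise affine sigmoid: 0 for x ≤ a, (x-a)/(b-a) for a ≤ x ≤ b, 1 for x ≥ b. -/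
noncomputable def sig (a b x : ℝ) : ℝ :=
  if x ≤ a then 0 else if x ≤ b then (x - a) / (b - a) else 1

/-- The radix-4 encoding of a sequence of digits. -/
noncomputable def enc (w : ℕ → ℝ) : ℝ := ∑' n : ℕ, w n / 4 ^ (n + 1)

/-- Approximation of the integer part on the encoding set. -/
noncomputable def σ' (x : ℝ) : ℝ := sig (1/4) (3/4) x + 2 * sig (9/4) (11/4) x

/-- Approximation of the fractional part on the encoding set. -/
noncomputable def ξ (x : ℝ) : ℝ := x - σ' x

/-- The geometric series with ratio `1/4`, scaled by `c`, sums to `c / 3`. -/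
lemma hasSum_const_div_four_pow (c : ℝ) :
    HasSum (fun n : ℕ => c / 4 ^ (n + 1)) (c / 3) := by
  have h := (hasSum_geometric_of_lt_one (r := (1 / 4 : ℝ)) (by norm_num) (by norm_num)).mul_left
    (c / 4)
  have hsum : c / 4 * (1 - 1 / 4)⁻¹ = c / 3 := by ring
  rw [hsum] at h
  refine (funext fun n => ?_ :
    (fun n : ℕ => c / 4 * (1 / 4) ^ n) = fun n => c / 4 ^ (n + 1)) ▸ h
  rw [one_div, inv_pow, pow_succ]
  field_simp

lemma summable_enc {w : ℕ → ℝ} {b : ℝ} (h0 : ∀ n, 0 ≤ w n) (hb : ∀ n, w n ≤ b) :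
    Summable (fun n : ℕ => w n / 4 ^ (n + 1)) := by
  refine Summable.of_nonneg_of_le (fun n => ?_) (fun n => ?_) (hasSum_const_div_four_pow b).summable
  · have := h0 n
    positivity
  · gcongr
    exact hb n

lemma enc_mem_Icc {w : ℕ → ℝ} {a b : ℝ} (ha0 : 0 ≤ a) (hw : ∀ n, w n ∈ Set.Icc a b) :
    enc w ∈ Set.Icc (a / 3) (b / 3) := by
  have hs := (summable_enc (fun n => ha0.trans (hw n).1) fun n => (hw n).2).hasSum
  refine ⟨hasSum_le (fun n => ?_) (hasSum_const_div_four_pow a) hs,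
    hasSum_le (fun n => ?_) hs (hasSum_const_div_four_pow b)⟩
  · gcongr
    exact (hw n).1
  · gcongr
    exact (hw n).2

lemma four_mul_enc {w : ℕ → ℝ} (hs : Summable (fun n : ℕ => w n / 4 ^ (n + 1))) :
    4 * enc w = w 0 + enc (fun n => w (n + 1)) := by
  unfold enc
  rw [hs.tsum_eq_zero_add, mul_add, ← tsum_mul_left]
  congr 1
  · ring
  · refine tsum_congr fun n => ?_
    rw [pow_succ _ (n + 1)]
    field_simp

lemma sig_of_le {a b x : ℝ} (h : x ≤ a) : sig a b x = 0 := if_pos h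

lemma sig_of_lt {a b x : ℝ} (hab : a ≤ b) (h : b < x) : sig a b x = 1 := by
  rw [sig, if_neg (hab.trans_lt h).not_ge, if_neg h.not_ge]

theorem digit_extraction (w : ℕ → ℝ) (hw : ∀ n, w n = 1 ∨ w n = 3) :
    1/3 ≤ enc w ∧ enc w ≤ 1 ∧
      σ' (4 * enc w) = w 0 ∧
      ξ (4 * enc w) = enc (fun n => w (n + 1)) := by
  have hmem : ∀ n, w n ∈ Set.Icc (1 : ℝ) 3 := fun n => by
    rcases hw n with h | h <;> rw [h] <;> norm_num
  have hshift := four_mul_enc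
    (summable_enc (fun n => zero_le_one.trans (hmem n).1) fun n => (hmem n).2)
  obtain ⟨hl, hu⟩ := enc_mem_Icc zero_le_one hmem
  obtain ⟨hl', hu'⟩ := enc_mem_Icc zero_le_one fun n => hmem (n + 1)
  have hσ : σ' (4 * enc w) = w 0 := by
    rw [σ', sig_of_lt (by norm_num) (by linarith)]
    rcases hw 0 with h | h
    · rw [sig_of_le (by linarith), h]
      norm_num
    · rw [sig_of_lt (by norm_num) (by linarith), h]
      norm_num
  refine ⟨hl, by linarith, hσ, ?_⟩
  rw [ξ, hσ, hshift]
  ring
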